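/- Consider simple-versus-composite testing where the null model is the singleton 𝓜₀ = {p_{μ₀}} (so p_{B,0} = p_{μ₀}) and the alternative 𝓜₁ = {p_μ : μ ∈ M₁} is an exponential family in its mean-value parameterization with Bayes marginal p_{B,1}. Let p_{sw,1} be the switch distribution, and let r_sw(xⁿ) = p_{μ₀}(xⁿ)/p_{sw,1}(xⁿ). If X₁, X₂, … are i.i.d. with density p_{μ₀}, then for every α ∈ (0,1]: P_{μ₀}(∃ n : r_sw(Xⁿ) ≤ α) ≤ α; that is, the switch criterion defines a robust null hypothesis test whose Type-I error probability is bounded by α irrespective of the stopping rule. -/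

import Mathlib

open MeasureTheory ProbabilityTheory Real Set
open scoped ENNReal BigOperators

noncomputable section

namespace SwitchPaper

variable {𝒳 : Type*} [MeasurableSpace 𝒳]

/-- Squared Euclidean distance `‖a − b‖₂²`. -/
def sqDist {m : ℕ} (a b : Fin m → ℝ) : ℝ := ∑ j, (a j - b j) ^ 2

/-- Euclidean inner product. -/
def dot {m : ℕ} (a b : Fin m → ℝ) : ℝ := ∑ j, a j * b j

/-- A CINECSI subset of `M`: a Connected subset of the interior of `M` that is itself
Compact and has NonEmpty interior. -/
def CINECSI {m : ℕ} (M' M : Set (Fin m → ℝ)) : Prop :=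
  IsConnected M' ∧ M' ⊆ interior M ∧ IsCompact M' ∧ (interior M').Nonempty

/-- Hellinger affinity `∫ √(p q) dν = E_{p}[√(q/p)]` between two densities w.r.t. `ν`. -/
def hellingerAffinity (ν : Measure 𝒳) (p q : 𝒳 → ℝ) : ℝ := ∫ x, Real.sqrt (p x * q x) ∂ν

/-- Squared Hellinger distance `d_{H²}(p,q) = 2(1 − E_p[√(q/p)])`. -/
def dH2 (ν : Measure 𝒳) (p q : 𝒳 → ℝ) : ℝ := 2 * (1 - hellingerAffinity ν p q)

/-- Rényi divergence of order 1/2, `d_R(p,q) = −2 log E_p[√(q/p)]`; it is symmetric. -/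
def dRenyiHalf (ν : Measure 𝒳) (p q : 𝒳 → ℝ) : ℝ := -2 * Real.log (hellingerAffinity ν p q)

/-- Kullback–Leibler divergence `D(p‖q) = ∫ p log(p/q) dν` between densities w.r.t. `ν`. -/
def klDiv' (ν : Measure 𝒳) (p q : 𝒳 → ℝ) : ℝ := ∫ x, p x * Real.log (p x / q x) ∂ν

/-- `p : M → 𝒳 → ℝ` is an `m`-dimensional exponential family w.r.t. the base measure `ν`,
given in its mean-value parameterization: the densities have the exponential form
`p_μ(x) = exp(θ(μ)ᵀ φ(x) − ψ(θ(μ))) r(x)`, each `p_μ` is a probability density w.r.t. `ν`,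
the mean of the sufficient statistic `φ` under `p_μ` is `μ`, the parameter set `M` is an
open connected product of open intervals, and the representation is minimal (the components
of `φ`, together with constants, are affinely independent). -/
structure IsMeanValueExpFam {m : ℕ} (ν : Measure 𝒳) (M : Set (Fin m → ℝ))
    (p : (Fin m → ℝ) → 𝒳 → ℝ) (θ : (Fin m → ℝ) → (Fin m → ℝ))
    (φ : 𝒳 → (Fin m → ℝ)) (ψ : (Fin m → ℝ) → ℝ) (carrier : 𝒳 → ℝ) : Prop where
  carrier_pos : ∀ x, 0 < carrier x
  φ_meas : Measurable φ
  p_meas : ∀ μ, Measurable (p μ)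
  M_conn : IsConnected M
  M_prod : ∃ S : Fin m → Set ℝ, (∀ j, IsOpen (S j) ∧ (S j).OrdConnected) ∧ M = Set.univ.pi S
  p_form : ∀ μ ∈ M, ∀ x, p μ x = Real.exp (dot (θ μ) (φ x) - ψ (θ μ)) * carrier x
  p_prob : ∀ μ ∈ M, ∫ x, p μ x ∂ν = 1
  φ_int : ∀ μ ∈ M, Integrable (fun x => (∑ j, |φ x j|) * p μ x) ν
  mean_eq : ∀ μ ∈ M, ∀ i, ∫ x, φ x i * p μ x ∂ν = μ i
  minimal : ∀ c : Fin m → ℝ, ∀ d : ℝ, (∀ x, dot c (φ x) = d) → c = 0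

/-- Covariance matrix of the sufficient statistic `φ` under `p_μ`. -/
def covMatrix {m : ℕ} (ν : Measure 𝒳) (p : (Fin m → ℝ) → 𝒳 → ℝ) (φ : 𝒳 → (Fin m → ℝ))
    (μ : Fin m → ℝ) : Matrix (Fin m) (Fin m) ℝ :=
  Matrix.of fun i j => ∫ x, (φ x i - μ i) * (φ x j - μ j) * p μ x ∂ν

/-- Fisher information matrix in the mean-value parameterization: the inverse of the
covariance matrix of the sufficient statistic. -/
def fisherInfo {m : ℕ} (ν : Measure 𝒳) (p : (Fin m → ℝ) → 𝒳 → ℝ) (φ : 𝒳 → (Fin m → ℝ))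
    (μ : Fin m → ℝ) : Matrix (Fin m) (Fin m) ℝ := (covMatrix ν p φ μ)⁻¹

/-- Quadratic form `vᵀ J v`. -/
def quadForm {m : ℕ} (J : Matrix (Fin m) (Fin m) ℝ) (v : Fin m → ℝ) : ℝ :=
  ∑ i, ∑ j, v i * J i j * v j

/-- Standardized squared error (squared Mahalanobis distance)
`d_ST(a ‖ b) = (b − a)ᵀ I(a) (b − a)`, with `I` the Fisher information. -/
def dST {m : ℕ} (ν : Measure 𝒳) (p : (Fin m → ℝ) → 𝒳 → ℝ) (φ : 𝒳 → (Fin m → ℝ))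
    (a b : Fin m → ℝ) : ℝ := quadForm (fisherInfo ν p φ a) (b - a)

/-- Joint density (likelihood) of an i.i.d. sample. -/
def likelihood {m : ℕ} (p : (Fin m → ℝ) → 𝒳 → ℝ) (μ : Fin m → ℝ) {n : ℕ}
    (xs : Fin n → 𝒳) : ℝ := ∏ i, p μ (xs i)

/-- The law of `n` i.i.d. observations, each with density `f` w.r.t. `ν`. -/
def iidLaw (ν : Measure 𝒳) (f : 𝒳 → ℝ) (n : ℕ) : Measure (Fin n → 𝒳) :=
  (Measure.pi fun _ : Fin n => ν).withDensity fun xs => ENNReal.ofReal (∏ i, f (xs i))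

/-- The (raw) maximum likelihood estimator of an exponential family in its mean-value
parameterization: the empirical mean of the sufficient statistic. -/
def mleRaw {m : ℕ} (φ : 𝒳 → (Fin m → ℝ)) {n : ℕ} (xs : Fin n → 𝒳) : Fin m → ℝ :=
  fun j => (∑ i, φ (xs i) j) / n

/-- Projection `Π₀` onto the simple model: keep the first `m₀` coordinates, replace the
remaining ones by the fixed values. -/
def proj0 {m₁ : ℕ} (m₀ : ℕ) (fixed : Fin m₁ → ℝ) (μ : Fin m₁ → ℝ) : Fin m₁ → ℝ :=
  fun j => if (j : ℕ) < m₀ then μ j else fixed j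

/-- The parameter set of the nested submodel `𝓜₀`: the last `m₁ − m₀` coordinates are
fixed to known values. -/
def nestedSub {m₁ : ℕ} (m₀ : ℕ) (M₁ : Set (Fin m₁ → ℝ)) (fixed : Fin m₁ → ℝ) :
    Set (Fin m₁ → ℝ) := {μ ∈ M₁ | ∀ j : Fin m₁, m₀ ≤ (j : ℕ) → μ j = fixed j}

/-- Embedding of the `m₀`-dimensional parameter of the simple model into `ℝ^{m₁}`. -/
def embed0 {m₀ m₁ : ℕ} (h : m₀ ≤ m₁) (fixed : Fin m₁ → ℝ) (t : Fin m₀ → ℝ) : Fin m₁ → ℝ :=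
  fun j => if hj : (j : ℕ) < m₀ then t ⟨(j : ℕ), hj⟩ else fixed j

/-- Bayes marginal density of a sample: `p_B(xⁿ) = ∫_M w(μ) p_μ(xⁿ) dμ`. -/
def bayesMarginal {m : ℕ} (p : (Fin m → ℝ) → 𝒳 → ℝ) (M : Set (Fin m → ℝ))
    (w : (Fin m → ℝ) → ℝ) {n : ℕ} (xs : Fin n → 𝒳) : ℝ :=
  ∫ μ in M, w μ * likelihood p μ xs

/-- The first `k` observations of a sample of size `n ≥ k`. -/
def prefixObs {n : ℕ} (xs : Fin n → 𝒳) (k : ℕ) (h : k ≤ n) : Fin k → 𝒳 :=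
  fun i => xs (Fin.castLE h i)

/-- The strategy `p̄_t` that switches from the simple to the complex model after `t − 1`
observations: `p̄_t(xⁿ) = p_{B,0}(x^{t−1}) · p_{B,1}(x_t,…,x_n | x^{t−1})`. -/
def pBar (pB0 pB1 : (k : ℕ) → (Fin k → 𝒳) → ℝ) (t : ℕ) {n : ℕ} (xs : Fin n → 𝒳) : ℝ :=
  if h : t - 1 < n then
    pB0 (t - 1) (prefixObs xs (t - 1) h.le) * pB1 n xs / pB1 (t - 1) (prefixObs xs (t - 1) h.le)
  else pB0 n xs

/-- The switch distribution `p_{sw,1}(xⁿ) = Σ_t π(t) p̄_t(xⁿ)`. -/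
def pSwitch (pB0 pB1 : (k : ℕ) → (Fin k → 𝒳) → ℝ) (pri : ℕ → ℝ) {n : ℕ} (xs : Fin n → 𝒳) : ℝ :=
  ∑' t : ℕ, pri t * pBar pB0 pB1 t xs

/-- A prior on switching times supported on powers of two, with `π(2^i) ∝ i^{−κ}`. -/
def SwitchPrior (pri : ℕ → ℝ) (κ : ℝ) : Prop :=
  (∀ t, 0 ≤ pri t) ∧ (∑' t : ℕ, pri t = 1) ∧ (∀ t, pri t ≠ 0 → ∃ i : ℕ, t = 2 ^ i) ∧ 0 < pri 1 ∧
    ∃ c > 0, ∀ i : ℕ, 1 ≤ i → pri (2 ^ i) = c * (i : ℝ) ^ (-κ)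

/-- The event (at sample size `n`) that the switch criterion selects the simple model,
i.e. `p_{sw,1}(xⁿ)/p_{B,0}(xⁿ) ≤ 1`. -/
def swSelectsSimple (pB0 pB1 : (k : ℕ) → (Fin k → 𝒳) → ℝ) (pri : ℕ → ℝ) (n : ℕ) :
    Set (Fin n → 𝒳) := {xs | pSwitch pB0 pB1 pri xs / pB0 n xs ≤ 1}

/-- `small_b(n)`: equal to `1` for `n < b₁` and to `b₂ e^{−b₃ n}` for `n ≥ b₁`. -/
def smallFn (b₁ b₂ b₃ : ℝ) (n : ℕ) : ℝ :=
  if (n : ℝ) < b₁ then 1 else b₂ * Real.exp (-b₃ * n)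

/-- Estimators `μ̆₀, μ̆₁` are sufficiently efficient (with constant `C`, on the set `M₁'`)
w.r.t. the divergence `dgen`: for all `n` and `μ₁ ∈ M₁'`, the risks
`E_{μ₁}[dgen(μ₀, μ̆₀(Xⁿ))]` and `E_{μ₁}[dgen(μ₁, μ̆₁(Xⁿ))]` are bounded by `C/n`,
where `μ₀ = Π₀(μ₁)`. -/
def SuffEff {m₁ : ℕ} (ν : Measure 𝒳) (p : (Fin m₁ → ℝ) → 𝒳 → ℝ) (m₀ : ℕ)
    (fixed : Fin m₁ → ℝ) (M₁' : Set (Fin m₁ → ℝ))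
    (dgen : (Fin m₁ → ℝ) → (Fin m₁ → ℝ) → ℝ)
    (est0 est1 : (n : ℕ) → (Fin n → 𝒳) → (Fin m₁ → ℝ)) (C : ℝ) : Prop :=
  0 < C ∧ ∀ n : ℕ, 0 < n → ∀ μ₁ ∈ M₁',
    (∫ xs, dgen (proj0 m₀ fixed μ₁) (est0 n xs) ∂(iidLaw ν (p μ₁) n)) ≤ C / n ∧
    (∫ xs, dgen μ₁ (est1 n xs) ∂(iidLaw ν (p μ₁) n)) ≤ C / n

end SwitchPaper

namespace SwitchPaper

/-- Ville's maximal inequality for `ℝ≥0∞`-valued supermartingales. -/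
theorem ville_inequality {Ω : Type*} {mΩ : MeasurableSpace Ω} (P : Measure Ω)
    (ℱ : ℕ → MeasurableSpace Ω) (hmono : Monotone ℱ) (hle : ∀ n, ℱ n ≤ mΩ)
    (L : ℕ → Ω → ℝ≥0∞) (hL : ∀ n, Measurable[ℱ n] (L n))
    (hsuper : ∀ n s, MeasurableSet[ℱ n] s → ∫⁻ ω in s, L (n + 1) ω ∂P ≤ ∫⁻ ω in s, L n ω ∂P)
    (c : ℝ≥0∞) :
    c * P {ω | ∃ n, c ≤ L n ω} ≤ ∫⁻ ω, L 0 ω ∂P := by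
  set B : ℕ → Set Ω := fun N => {ω | ∃ n ≤ N, c ≤ L n ω} with hB
  have hhit : ∀ n, MeasurableSet[ℱ n] {ω | c ≤ L n ω} := fun n =>
    @measurableSet_le _ _ _ _ _ (ℱ n) _ _ _ _ _ (@measurable_const _ _ _ (ℱ n) c) (hL n)
  have hBsucc : ∀ N, B (N + 1) = B N ∪ ((B N)ᶜ ∩ {ω | c ≤ L (N + 1) ω}) := by
    intro N
    ext ω
    simp only [hB, mem_ofPred_eq, mem_union, mem_inter_iff, mem_compl_iff, Nat.le_succ_iff]
    grind
  have hBmeas : ∀ N, MeasurableSet[ℱ N] (B N) := by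
    intro N
    have : B N = ⋃ n ∈ Set.Iic N, {ω | c ≤ L n ω} := by ext; simp [hB]
    rw [this]
    exact @MeasurableSet.biUnion _ _ (ℱ N) _ _ (Set.to_countable _)
      fun n hn => hmono hn _ (hhit n)
  have key : ∀ N, c * P (B N) + ∫⁻ ω in (B N)ᶜ, L N ω ∂P ≤ ∫⁻ ω, L 0 ω ∂P := by
    have hsplit : ∀ (n : ℕ) (s t : Set Ω), MeasurableSet s → t = {ω | c ≤ L n ω} →
        c * P (s ∩ t) + ∫⁻ ω in s ∩ tᶜ, L n ω ∂P ≤ ∫⁻ ω in s, L n ω ∂P := by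
      rintro n s t hs rfl
      have ht : MeasurableSet {ω | c ≤ L n ω} := hle n _ (hhit n)
      rw [← lintegral_inter_add_sdiff (L n) s ht, sdiff_eq]
      gcongr
      exact setLIntegral_const (μ := P) _ c ▸
        setLIntegral_mono' (hs.inter ht) fun ω hω => hω.2
    intro N
    induction N with
    | zero =>
      have h0 : B 0 = {ω | c ≤ L 0 ω} := by ext; simp [hB]
      simpa [h0] using hsplit 0 univ _ MeasurableSet.univ rfl
    | succ N ih =>
      have hN : MeasurableSet (B N) := hle N _ (hBmeas N)
      have hcompl : (B (N + 1))ᶜ = (B N)ᶜ ∩ {ω | c ≤ L (N + 1) ω}ᶜ := by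
        rw [hBsucc, compl_union, compl_inter, compl_compl]
        ext ω
        simp only [mem_inter_iff, mem_union, mem_compl_iff]
        tauto
      calc c * P (B (N + 1)) + ∫⁻ ω in (B (N + 1))ᶜ, L (N + 1) ω ∂P
          ≤ c * P (B N) + (c * P ((B N)ᶜ ∩ {ω | c ≤ L (N + 1) ω})
              + ∫⁻ ω in (B N)ᶜ ∩ {ω | c ≤ L (N + 1) ω}ᶜ, L (N + 1) ω ∂P) := by
            rw [hcompl, ← add_assoc, ← mul_add, hBsucc]
            gcongr
            exact measure_union_le _ _
        _ ≤ c * P (B N) + ∫⁻ ω in (B N)ᶜ, L (N + 1) ω ∂P := by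
            gcongr
            exact hsplit _ _ _ hN.compl rfl
        _ ≤ c * P (B N) + ∫⁻ ω in (B N)ᶜ, L N ω ∂P := by
            exact add_le_add_right (hsuper N _ (@MeasurableSet.compl _ _ (ℱ N) (hBmeas N))) _
        _ ≤ _ := ih
  have hBmono : Monotone B := fun N N' h ω ⟨n, hn, hc⟩ => ⟨n, hn.trans h, hc⟩
  have hunion : {ω | ∃ n, c ≤ L n ω} = ⋃ N, B N := by
    ext ω
    simp only [hB, mem_ofPred_eq, mem_iUnion]
    exact ⟨fun ⟨n, h⟩ => ⟨n, n, le_rfl, h⟩, fun ⟨_, n, _, h⟩ => ⟨n, h⟩⟩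
  rw [hunion, hBmono.measure_iUnion, ENNReal.mul_iSup]
  exact iSup_le fun N => le_self_add.trans (key N)

/-- The σ-algebra generated by the first `n` observations. -/
@[reducible]
def pastSigma {Ω 𝒳 : Type*} [MeasurableSpace 𝒳] (X : ℕ → Ω → 𝒳) (n : ℕ) : MeasurableSpace Ω :=
  ⨆ i ∈ Set.Iio n, MeasurableSpace.comap (X i) inferInstance

theorem pastSigma_mono {Ω 𝒳 : Type*} [MeasurableSpace 𝒳] (X : ℕ → Ω → 𝒳) :
    Monotone (pastSigma X) :=
  fun _ _ h => biSup_mono fun _ hi => lt_of_lt_of_le hi h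

theorem pastSigma_le {Ω 𝒳 : Type*} [MeasurableSpace 𝒳] {mΩ : MeasurableSpace Ω}
    {X : ℕ → Ω → 𝒳} (hX : ∀ i, Measurable (X i)) (n : ℕ) : pastSigma X n ≤ mΩ :=
  iSup₂_le fun i _ => (hX i).comap_le

theorem measurable_pastSigma {Ω 𝒳 : Type*} [MeasurableSpace 𝒳] (X : ℕ → Ω → 𝒳) {i n : ℕ}
    (h : i < n) : Measurable[pastSigma X n] (X i) :=
  measurable_iff_comap_le.2 (le_iSup₂_of_le i h le_rfl)

/-- The mixture over `Λ` of the likelihood ratios `∏ i < n, ρ μ (x i)`. -/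
def mixtureRatio {Θ 𝒳 : Type*} [MeasurableSpace Θ] (Λ : Measure Θ) (ρ : Θ → 𝒳 → ℝ≥0∞)
    (x : ℕ → 𝒳) (n : ℕ) : ℝ≥0∞ :=
  ∫⁻ μ, ∏ i ∈ Finset.range n, ρ μ (x i) ∂Λ

section Mixture

variable {Θ 𝒳 Ω : Type*} [MeasurableSpace Θ] [MeasurableSpace 𝒳]
  {Λ : Measure Θ} {ρ : Θ → 𝒳 → ℝ≥0∞} {X : ℕ → Ω → 𝒳}

theorem measurable_prod_ratio [MeasurableSpace Ω] (hρ : Measurable (Function.uncurry ρ)) (n : ℕ)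
    (hX : ∀ i < n, Measurable (X i)) :
    Measurable fun z : Ω × Θ => ∏ i ∈ Finset.range n, ρ z.2 (X i z.1) :=
  Finset.measurable_fun_prod _ fun i hi => hρ.comp
    (measurable_snd.prodMk ((hX i (Finset.mem_range.1 hi)).comp measurable_fst))

theorem measurable_mixtureRatio [MeasurableSpace Ω] [SFinite Λ]
    (hρ : Measurable (Function.uncurry ρ)) (n : ℕ) (hX : ∀ i < n, Measurable (X i)) :
    Measurable fun ω => mixtureRatio Λ ρ (fun i => X i ω) n :=
  (measurable_prod_ratio hρ n hX).lintegral_prod_right'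

theorem measurable_pastSigma_mixtureRatio [SFinite Λ] (hρ : Measurable (Function.uncurry ρ))
    {k n : ℕ} (hkn : k ≤ n) :
    Measurable[pastSigma X n] fun ω => mixtureRatio Λ ρ (fun i => X i ω) k :=
  @measurable_mixtureRatio _ _ _ _ _ _ _ _ (pastSigma X n) _ hρ k
    fun _ hi => measurable_pastSigma X (hi.trans_le hkn)

theorem lintegral_mul_mixtureRatio_succ_le [mΩ : MeasurableSpace Ω] {P : Measure Ω}
    [IsProbabilityMeasure P] [SFinite Λ] (hρ : Measurable (Function.uncurry ρ))
    (hX : ∀ i, Measurable (X i)) (hindep : iIndepFun X P)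
    (hint : ∀ᵐ μ ∂Λ, ∀ i, ∫⁻ ω, ρ μ (X i ω) ∂P ≤ 1) (n : ℕ) (F : Ω → ℝ≥0∞)
    (hF : Measurable[pastSigma X n] F) :
    ∫⁻ ω, F ω * mixtureRatio Λ ρ (fun i => X i ω) (n + 1) ∂P
      ≤ ∫⁻ ω, F ω * mixtureRatio Λ ρ (fun i => X i ω) n ∂P := by
  have hF' : Measurable F := hF.mono (pastSigma_le hX n) le_rfl
  have hind : Indep (pastSigma X n) (MeasurableSpace.comap (X n) inferInstance) P := by
    have h := indep_iSup_of_disjoint (fun i => (hX i).comap_le) hindep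
      (S := Set.Iio n) (T := {n}) (by simp)
    simpa [pastSigma] using h
  have hswap : ∀ k, ∫⁻ ω, F ω * mixtureRatio Λ ρ (fun i => X i ω) k ∂P
      = ∫⁻ μ, ∫⁻ ω, F ω * ∏ i ∈ Finset.range k, ρ μ (X i ω) ∂P ∂Λ := by
    intro k
    have hk := measurable_prod_ratio (X := X) hρ k fun i _ => hX i
    rw [← lintegral_lintegral_swap ((hF'.comp measurable_fst).mul hk).aemeasurable]
    refine lintegral_congr fun ω => ?_
    rw [mixtureRatio, lintegral_const_mul]
    exact hk.comp (measurable_const.prodMk measurable_id)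
  rw [hswap, hswap]
  refine lintegral_mono_ae ?_
  filter_upwards [hint] with μ hμ
  have hρμ : Measurable (ρ μ) := hρ.comp (measurable_const.prodMk measurable_id)
  have hpast : Measurable[pastSigma X n] fun ω => F ω * ∏ i ∈ Finset.range n, ρ μ (X i ω) :=
    hF.fun_mul (Finset.measurable_fun_prod _ fun i hi =>
      hρμ.comp (measurable_pastSigma X (Finset.mem_range.1 hi)))
  simp_rw [Finset.prod_range_succ, ← mul_assoc]
  rw [lintegral_mul_eq_lintegral_mul_lintegral_of_independent_measurableSpace
    (g := fun ω => ρ μ (X n ω)) (pastSigma_le hX n) (hX n).comap_le hind hpast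
    (hρμ.comp (comap_measurable (X n)))]
  exact mul_le_of_le_one_right' (hμ n)

/-- The likelihood ratio of the strategy switching to the mixture at time `t`. -/
def switchRatio (Λ : Measure Θ) (ρ : Θ → 𝒳 → ℝ≥0∞) (x : ℕ → 𝒳) (t n : ℕ) : ℝ≥0∞ :=
  if t - 1 < n then (mixtureRatio Λ ρ x (t - 1))⁻¹ * mixtureRatio Λ ρ x n else 1

theorem measurable_pastSigma_switchRatio [SFinite Λ] (hρ : Measurable (Function.uncurry ρ))
    (t n : ℕ) : Measurable[pastSigma X n] fun ω => switchRatio Λ ρ (fun i => X i ω) t n := by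
  unfold switchRatio
  split_ifs with h
  · exact (measurable_pastSigma_mixtureRatio hρ h.le).inv.fun_mul
      (measurable_pastSigma_mixtureRatio hρ le_rfl)
  · exact measurable_const

theorem setLIntegral_switchRatio_succ_le [mΩ : MeasurableSpace Ω] {P : Measure Ω}
    [IsProbabilityMeasure P] [SFinite Λ] (hρ : Measurable (Function.uncurry ρ))
    (hX : ∀ i, Measurable (X i)) (hindep : iIndepFun X P)
    (hint : ∀ᵐ μ ∂Λ, ∀ i, ∫⁻ ω, ρ μ (X i ω) ∂P ≤ 1) (t n : ℕ) (s : Set Ω)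
    (hs : MeasurableSet[pastSigma X n] s) :
    ∫⁻ ω in s, switchRatio Λ ρ (fun i => X i ω) t (n + 1) ∂P
      ≤ ∫⁻ ω in s, switchRatio Λ ρ (fun i => X i ω) t n ∂P := by
  rcases lt_or_ge n (t - 1) with h | h
  · simp [switchRatio, h.not_gt, Nat.not_lt.2 (Nat.succ_le_of_lt h)]
  have hs' : MeasurableSet s := pastSigma_le hX n _ hs
  set R : ℕ → Ω → ℝ≥0∞ := fun k ω => mixtureRatio Λ ρ (fun i => X i ω) k with hR
  have hF : Measurable[pastSigma X n] (s.indicator fun ω => (R (t - 1) ω)⁻¹) :=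
    (measurable_pastSigma_mixtureRatio hρ h).inv.indicator hs
  have hset : ∀ k, ∫⁻ ω in s, (R (t - 1) ω)⁻¹ * R k ω ∂P
      = ∫⁻ ω, s.indicator (fun ω => (R (t - 1) ω)⁻¹) ω * R k ω ∂P := by
    intro k
    rw [← lintegral_indicator hs']
    simp_rw [← Set.indicator_mul_left]
  have hstep : ∫⁻ ω in s, (R (t - 1) ω)⁻¹ * R (n + 1) ω ∂P
      ≤ ∫⁻ ω in s, (R (t - 1) ω)⁻¹ * R n ω ∂P := by
    rw [hset, hset]
    exact lintegral_mul_mixtureRatio_succ_le hρ hX hindep hint n _ hF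
  simp only [switchRatio, Nat.lt_succ_of_le h, if_true]
  refine hstep.trans (lintegral_mono fun ω => ?_)
  split_ifs with h'
  · exact le_rfl
  · rw [show t - 1 = n by omega]
    exact ENNReal.inv_mul_le_one _

/-- Under i.i.d. sampling from the reference law, a `w`-mixture of switching strategies
exceeds the level `c` at some time with probability at most `1 / c`. -/
theorem mul_measure_exists_le_tsum_switchRatio_le [mΩ : MeasurableSpace Ω] {P : Measure Ω}
    [IsProbabilityMeasure P] [SFinite Λ] (hρ : Measurable (Function.uncurry ρ))
    (hX : ∀ i, Measurable (X i)) (hindep : iIndepFun X P)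
    (hint : ∀ᵐ μ ∂Λ, ∀ i, ∫⁻ ω, ρ μ (X i ω) ∂P ≤ 1) (w : ℕ → ℝ≥0∞) (hw : ∑' t, w t = 1)
    (c : ℝ≥0∞) :
    c * P {ω | ∃ n, c ≤ ∑' t, w t * switchRatio Λ ρ (fun i => X i ω) t n} ≤ 1 := by
  have hmeas : ∀ n t, Measurable[pastSigma X n]
      fun ω => w t * switchRatio Λ ρ (fun i => X i ω) t n := fun n t =>
    (measurable_pastSigma_switchRatio hρ t n).const_mul (w t)
  have hmeas' : ∀ n t, Measurable fun ω => switchRatio Λ ρ (fun i => X i ω) t n := fun n t =>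
    (measurable_pastSigma_switchRatio hρ t n).mono (pastSigma_le hX n) le_rfl
  refine (ville_inequality P (pastSigma X) (pastSigma_mono X) (pastSigma_le hX) _
    (fun n => by let := pastSigma X n; exact Measurable.tsum (hmeas n)) ?_ c).trans ?_
  · intro n s hs
    rw [lintegral_tsum fun t => ((hmeas' _ t).const_mul _).aemeasurable,
      lintegral_tsum fun t => ((hmeas' _ t).const_mul _).aemeasurable]
    refine ENNReal.tsum_le_tsum fun t => ?_
    rw [lintegral_const_mul _ (hmeas' _ t), lintegral_const_mul _ (hmeas' _ t)]
    exact mul_le_mul_right (setLIntegral_switchRatio_succ_le hρ hX hindep hint t n s hs) _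
  · simp [switchRatio, hw]

theorem lintegral_mixtureRatio_le [mΩ : MeasurableSpace Ω] {P : Measure Ω}
    [IsProbabilityMeasure P] [SFinite Λ] (hρ : Measurable (Function.uncurry ρ))
    (hX : ∀ i, Measurable (X i)) (hindep : iIndepFun X P)
    (hint : ∀ᵐ μ ∂Λ, ∀ i, ∫⁻ ω, ρ μ (X i ω) ∂P ≤ 1) (n : ℕ) :
    ∫⁻ ω, mixtureRatio Λ ρ (fun i => X i ω) n ∂P ≤ Λ univ := by
  induction n with
  | zero => simp [mixtureRatio]
  | succ n ih =>
    refine le_trans ?_ ih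
    simpa using lintegral_mul_mixtureRatio_succ_le hρ hX hindep hint n (fun _ => 1)
      measurable_const

end Mixture

/-- A locally Lipschitz function on an open set of a finite-dimensional space is differentiable
at almost every point of the set. -/
theorem ae_differentiableAt_of_locallyLipschitzOn {m : ℕ} {M : Set (Fin m → ℝ)} (hM : IsOpen M)
    {f : (Fin m → ℝ) → ℝ} (hf : LocallyLipschitzOn M f) :
    ∀ᵐ x ∂(volume : Measure (Fin m → ℝ)).restrict M, DifferentiableAt ℝ f x := by
  rw [ae_restrict_iff' hM.measurableSet, ae_iff]
  refine measure_null_of_locally_null _ fun x hx => ?_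
  obtain ⟨hxM, -⟩ : x ∈ M ∧ ¬ DifferentiableAt ℝ f x := by simpa using hx
  obtain ⟨K, t, ht, hK⟩ := hf hxM
  rw [hM.nhdsWithin_eq hxM] at ht
  obtain ⟨u, hut, hu, hxu⟩ := mem_nhds_iff.1 ht
  have hdiff := (hK.mono hut).ae_differentiableWithinAt_of_mem
    (μ := (volume : Measure (Fin m → ℝ)))
  refine ⟨{y | ¬ (y ∈ M → DifferentiableAt ℝ f y)} ∩ u,
    Filter.inter_mem self_mem_nhdsWithin (mem_nhdsWithin_of_mem_nhds (hu.mem_nhds hxu)), ?_⟩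
  refine measure_mono_null (fun y hy => ?_) (ae_iff.1 hdiff)
  intro h
  exact hy.1 fun _ => (h hy.2).differentiableAt (hu.mem_nhds hy.2)

/-- A selection of subgradients on a convex open set is almost everywhere measurable, as is the
function itself. -/
theorem aemeasurable_of_subgradient {m : ℕ} {M : Set (Fin m → ℝ)} (hM : IsOpen M)
    (hconv : Convex ℝ M) {f : (Fin m → ℝ) → ℝ} {g : (Fin m → ℝ) → (Fin m → ℝ)}
    (hg : ∀ x ∈ M, ∀ y ∈ M, f x + dot (g x) (y - x) ≤ f y) :
    AEMeasurable f (volume.restrict M) ∧ AEMeasurable g (volume.restrict M) := by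
  have hdot_add : ∀ a x y : Fin m → ℝ, ∀ s t : ℝ,
      dot a (s • x + t • y) = s * dot a x + t * dot a y := by
    intro a x y s t
    simp only [dot, Pi.add_apply, Pi.smul_apply, smul_eq_mul, Finset.mul_sum,
      ← Finset.sum_add_distrib]
    exact Finset.sum_congr rfl fun j _ => by ring
  have hf : ConvexOn ℝ M f := by
    refine ⟨hconv, fun x hx y hy a b ha hb hab => ?_⟩
    set z := a • x + b • y with hz
    have hzM : z ∈ M := hconv hx hy ha hb hab
    have h1 := mul_le_mul_of_nonneg_left (hg z hzM x hx) ha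
    have h2 := mul_le_mul_of_nonneg_left (hg z hzM y hy) hb
    have hcombine : a * dot (g z) (x - z) + b * dot (g z) (y - z) = 0 := by
      rw [← hdot_add]
      have : a • (x - z) + b • (y - z) = 0 := by
        rw [smul_sub, smul_sub, sub_add_sub_comm, ← add_smul, hab, one_smul, ← hz, sub_self]
      rw [this]
      simp [dot]
    simp only [smul_eq_mul]
    have : f z = a * f z + b * f z := by rw [← add_mul, hab, one_mul]
    linarith
  refine ⟨(hf.continuousOn hM).aemeasurable hM.measurableSet, ?_⟩
  refine ⟨fun x j => fderiv ℝ f x (Pi.single j 1),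
    measurable_pi_lambda _ fun j => measurable_fderiv_apply_const ℝ f _, ?_⟩
  filter_upwards [ae_differentiableAt_of_locallyLipschitzOn hM (hf.locallyLipschitzOn hM),
    ae_restrict_mem hM.measurableSet] with x hdiff hx
  let A : (Fin m → ℝ) →L[ℝ] ℝ := ∑ j, g x j • ContinuousLinearMap.proj (R := ℝ) j
  have hA : ∀ y, A y = dot (g x) y := fun y => by
    simp [A, dot]
  have hmin : IsLocalMin (fun y => f y - A y) x := by
    filter_upwards [hM.mem_nhds hx] with y hy
    have h := hg x hx y hy
    rw [← hA, map_sub] at h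
    linarith
  have hzero := hmin.fderiv_eq_zero
  rw [fderiv_fun_sub hdiff A.differentiableAt, A.fderiv, sub_eq_zero] at hzero
  ext j
  rw [hzero, hA]
  simp [dot, Pi.single_apply]

section ExpFam

variable {m : ℕ} {𝒳 : Type*} [MeasurableSpace 𝒳] {ν : Measure 𝒳} {M : Set (Fin m → ℝ)}
  {p : (Fin m → ℝ) → 𝒳 → ℝ} {θ : (Fin m → ℝ) → (Fin m → ℝ)} {φ : 𝒳 → (Fin m → ℝ)}
  {ψ : (Fin m → ℝ) → ℝ} {carrier : 𝒳 → ℝ}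

theorem IsMeanValueExpFam.isOpen
    (hF : IsMeanValueExpFam ν M p θ φ ψ carrier) : IsOpen M := by
  obtain ⟨S, hS, rfl⟩ := hF.M_prod
  exact isOpen_set_pi finite_univ fun j _ => (hS j).1

theorem IsMeanValueExpFam.convex
    (hF : IsMeanValueExpFam ν M p θ φ ψ carrier) : Convex ℝ M := by
  obtain ⟨S, hS, rfl⟩ := hF.M_prod
  exact convex_pi fun j _ => (hS j).2.convex

theorem IsMeanValueExpFam.pos
    (hF : IsMeanValueExpFam ν M p θ φ ψ carrier) {μ : Fin m → ℝ} (hμ : μ ∈ M) (x : 𝒳) :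
    0 < p μ x := by
  rw [hF.p_form μ hμ]
  exact mul_pos (Real.exp_pos _) (hF.carrier_pos x)

theorem IsMeanValueExpFam.integrable
    (hF : IsMeanValueExpFam ν M p θ φ ψ carrier) {μ : Fin m → ℝ} (hμ : μ ∈ M) :
    Integrable (p μ) ν := by
  by_contra h
  have := hF.p_prob μ hμ
  rw [integral_undef h] at this
  exact zero_ne_one this

/-- Gibbs' inequality: among the members of the family, the expected log-likelihood under the
mean `μ` is maximal at `μ` itself. -/
theorem IsMeanValueExpFam.dot_sub_le
    (hF : IsMeanValueExpFam ν M p θ φ ψ carrier) {μ μ' : Fin m → ℝ} (hμ : μ ∈ M)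
    (hμ' : μ' ∈ M) : dot (θ μ') μ - ψ (θ μ') ≤ dot (θ μ) μ - ψ (θ μ) := by
  have hφ : ∀ j, Integrable (fun x => φ x j * p μ x) ν := fun j =>
    (hF.φ_int μ hμ).mono
      (((measurable_pi_apply j).comp hF.φ_meas).mul (hF.p_meas μ)).aestronglyMeasurable
      (ae_of_all _ fun x => by
        rw [norm_mul, norm_mul]
        gcongr
        rw [Real.norm_eq_abs, Real.norm_of_nonneg (Finset.sum_nonneg fun _ _ => abs_nonneg _)]
        exact Finset.single_le_sum (f := fun j => |φ x j|) (fun _ _ => abs_nonneg _)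
          (Finset.mem_univ j))
  have hdot : ∀ a : Fin m → ℝ, Integrable (fun x => dot a (φ x) * p μ x) ν ∧
      ∫ x, dot a (φ x) * p μ x ∂ν = dot a μ := by
    intro a
    have hrw : (fun x => dot a (φ x) * p μ x) = fun x => ∑ j, a j * (φ x j * p μ x) := by
      ext x
      simp only [dot, Finset.sum_mul, mul_assoc]
    rw [hrw]
    refine ⟨integrable_finsetSum _ fun j _ => (hφ j).const_mul _, ?_⟩
    rw [integral_finsetSum _ fun j _ => (hφ j).const_mul _]
    simp only [integral_const_mul, hF.mean_eq μ hμ, dot]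
  have hp := hF.integrable hμ
  have hp' := hF.integrable hμ'
  have hlin : ∀ a : Fin m → ℝ, ∀ b : ℝ, Integrable (fun x => dot a (φ x) * p μ x - b * p μ x) ν ∧
      ∫ x, (dot a (φ x) * p μ x - b * p μ x) ∂ν = dot a μ - b := by
    intro a b
    refine ⟨(hdot a).1.sub (hp.const_mul b), ?_⟩
    rw [integral_sub (hdot a).1 (hp.const_mul b), (hdot a).2, integral_const_mul,
      hF.p_prob μ hμ, mul_one]
  have hmono : ∫ x, ((dot (θ μ') (φ x) * p μ x - ψ (θ μ') * p μ x)
        - (dot (θ μ) (φ x) * p μ x - ψ (θ μ) * p μ x)) ∂ν ≤ ∫ x, (p μ' x - p μ x) ∂ν := by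
    refine integral_mono ((hlin _ _).1.sub (hlin _ _).1) (hp'.sub hp) fun x => ?_
    have h1 := Real.add_one_le_exp
      ((dot (θ μ') (φ x) - ψ (θ μ')) - (dot (θ μ) (φ x) - ψ (θ μ)))
    have h2 : p μ' x = Real.exp ((dot (θ μ') (φ x) - ψ (θ μ')) - (dot (θ μ) (φ x) - ψ (θ μ)))
        * p μ x := by
      rw [hF.p_form μ' hμ', hF.p_form μ hμ, ← mul_assoc, ← Real.exp_add, sub_add_cancel]
    have h3 := mul_le_mul_of_nonneg_right h1 (hF.pos hμ x).le
    rw [← h2] at h3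
    dsimp only
    linarith
  rw [integral_sub (hlin _ _).1 (hlin _ _).1, (hlin _ _).2, (hlin _ _).2, integral_sub hp' hp,
    hF.p_prob μ hμ, hF.p_prob μ' hμ'] at hmono
  linarith

theorem IsMeanValueExpFam.aemeasurable
    (hF : IsMeanValueExpFam ν M p θ φ ψ carrier) :
    AEMeasurable θ (volume.restrict M) ∧ AEMeasurable (fun μ => ψ (θ μ)) (volume.restrict M) := by
  obtain ⟨hf, hθ⟩ := aemeasurable_of_subgradient hF.isOpen hF.convex
    (f := fun μ => dot (θ μ) μ - ψ (θ μ)) (g := θ) fun x hx y hy => by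
      have h := hF.dot_sub_le hy hx
      have hsub : dot (θ x) (y - x) = dot (θ x) y - dot (θ x) x := by
        simp [dot, mul_sub, Finset.sum_sub_distrib]
      linarith
  refine ⟨hθ, ?_⟩
  have hdot : AEMeasurable (fun μ => dot (θ μ) μ) (volume.restrict M) :=
    Finset.aemeasurable_fun_sum _ fun j _ =>
      ((measurable_pi_apply j).comp_aemeasurable hθ).mul (measurable_pi_apply j).aemeasurable
  simpa using hdot.fun_sub hf

/-- The likelihood ratios `p μ x / p μ₀ x` admit a version that is jointly measurable
in `(μ, x)`. -/
theorem IsMeanValueExpFam.exists_measurable_ratio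
    (hF : IsMeanValueExpFam ν M p θ φ ψ carrier) {μ₀ : Fin m → ℝ}
    (hμ₀ : μ₀ ∈ M) :
    ∃ ρ : (Fin m → ℝ) → 𝒳 → ℝ≥0∞, Measurable (Function.uncurry ρ) ∧ (∀ μ x, ρ μ x ≠ 0) ∧
      ∀ᵐ μ ∂volume.restrict M, ∀ x, ρ μ x = ENNReal.ofReal (p μ x / p μ₀ x) := by
  obtain ⟨⟨T, hT, hθT⟩, ⟨S, hS, hψS⟩⟩ := hF.aemeasurable
  refine ⟨fun μ x => ENNReal.ofReal (Real.exp ((dot (T μ) (φ x) - S μ)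
    - (dot (θ μ₀) (φ x) - ψ (θ μ₀)))), ?_, fun μ x => by simp [Real.exp_pos], ?_⟩
  · have hdot : Measurable fun z : (Fin m → ℝ) × (Fin m → ℝ) => dot z.1 z.2 := by
      unfold dot
      fun_prop
    have hφ := hF.φ_meas
    exact (((hdot.comp ((hT.comp measurable_fst).prodMk (hφ.comp measurable_snd))).sub
      (hS.comp measurable_fst)).sub ((hdot.comp (measurable_const.prodMk
        (hφ.comp measurable_snd))).sub measurable_const)).exp.ennreal_ofReal
  · filter_upwards [hθT, hψS, ae_restrict_mem hF.isOpen.measurableSet] with μ h1 h2 hμ x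
    rw [← h1, ← h2, hF.p_form μ hμ, hF.p_form μ₀ hμ₀,
      mul_div_mul_right _ _ (hF.carrier_pos x).ne', Real.exp_sub]

theorem IsMeanValueExpFam.bayesMarginal_eq
    (hF : IsMeanValueExpFam ν M p θ φ ψ carrier) {μ₀ : Fin m → ℝ}
    (hμ₀ : μ₀ ∈ M) {w : (Fin m → ℝ) → ℝ} (hwc : ContinuousOn w M) (hw : ∀ μ ∈ M, 0 ≤ w μ)
    {ρ : (Fin m → ℝ) → 𝒳 → ℝ≥0∞} (hρ : Measurable (Function.uncurry ρ))
    (hρp : ∀ᵐ μ ∂volume.restrict M, ∀ x, ρ μ x = ENNReal.ofReal (p μ x / p μ₀ x))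
    (x : ℕ → 𝒳) (n : ℕ) :
    bayesMarginal p M w (fun i : Fin n => x i)
      = (mixtureRatio ((volume.restrict M).withDensity fun μ => ENNReal.ofReal (w μ)) ρ x n).toReal
        * ∏ i ∈ Finset.range n, p μ₀ (x i) := by
  have hM : MeasurableSet M := hF.isOpen.measurableSet
  have hwae : AEMeasurable w (volume.restrict M) := hwc.aemeasurable hM
  have hprod : Measurable fun μ => ∏ i ∈ Finset.range n, ρ μ (x i) :=
    Finset.measurable_fun_prod _ fun i _ => hρ.comp (measurable_id.prodMk measurable_const)
  set c : ℝ := ∏ i ∈ Finset.range n, p μ₀ (x i) with hc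
  have hcpos : 0 < c := Finset.prod_pos fun i _ => hF.pos hμ₀ _
  have hlik : ∀ᵐ μ ∂volume.restrict M, w μ * likelihood p μ (fun i : Fin n => x i)
      = w μ * (∏ i ∈ Finset.range n, ρ μ (x i)).toReal * c := by
    filter_upwards [hρp, ae_restrict_mem hM] with μ h hμ
    rw [likelihood, Fin.prod_univ_eq_prod_range (fun i => p μ (x i)), mul_assoc,
      ENNReal.toReal_prod, hc, ← Finset.prod_mul_distrib]
    congr 1
    refine Finset.prod_congr rfl fun i _ => ?_
    rw [h, ENNReal.toReal_ofReal (div_pos (hF.pos hμ _) (hF.pos hμ₀ _)).le,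
      div_mul_cancel₀ _ (hF.pos hμ₀ _).ne']
  have hfin : ∀ᵐ μ ∂volume.restrict M, ∏ i ∈ Finset.range n, ρ μ (x i) ≠ ∞ := by
    filter_upwards [hρp] with μ h
    exact ENNReal.prod_ne_top fun i _ => by simp [h]
  rw [bayesMarginal, integral_congr_ae hlik, integral_mul_const]
  congr 1
  rw [integral_eq_lintegral_of_nonneg_ae, mixtureRatio,
    lintegral_withDensity_eq_lintegral_mul₀ hwae.ennreal_ofReal hprod.aemeasurable]
  · congr 1
    refine lintegral_congr_ae ?_
    filter_upwards [hfin, ae_restrict_mem hM] with μ h hμ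
    rw [Pi.mul_apply, ENNReal.ofReal_mul (hw μ hμ), ENNReal.ofReal_toReal h]
  · filter_upwards [ae_restrict_mem hM] with μ hμ
    exact mul_nonneg (hw μ hμ) ENNReal.toReal_nonneg
  · exact (hwae.mul hprod.ennreal_toReal.aemeasurable).aestronglyMeasurable

end ExpFam

/-- with a singleton null `𝓜₀ = {p_{μ₀}}` (so `p_{B,0} = p_{μ₀}`) and the
switch distribution `p_{sw,1}` for the exponential family alternative, if the data are
i.i.d. `p_{μ₀}` then for every `α ∈ (0,1]`,
`P_{μ₀}(∃ n : p_{μ₀}(Xⁿ)/p_{sw,1}(Xⁿ) ≤ α) ≤ α`: the switch criterion defines a robust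
null hypothesis test. -/
theorem statement_6 {𝒳 : Type*} [MeasurableSpace 𝒳] {m : ℕ} (ν : Measure 𝒳) [SigmaFinite ν]
    (M₁ : Set (Fin m → ℝ)) (p : (Fin m → ℝ) → 𝒳 → ℝ)
    (θ : (Fin m → ℝ) → (Fin m → ℝ)) (φ : 𝒳 → (Fin m → ℝ)) (ψ : (Fin m → ℝ) → ℝ)
    (carrier : 𝒳 → ℝ)
    (hF : IsMeanValueExpFam ν M₁ p θ φ ψ carrier)
    -- the singleton null model:
    (μ₀ : Fin m → ℝ) (hμ₀ : μ₀ ∈ M₁)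
    -- a continuous strictly positive prior density on `M₁`:
    (ω₁ : (Fin m → ℝ) → ℝ) (hω₁c : ContinuousOn ω₁ M₁) (hω₁pos : ∀ μ ∈ M₁, 0 < ω₁ μ)
    (hω₁int : (∫ μ in M₁, ω₁ μ) = 1)
    -- the Bayes marginals of the two models:
    (pB0 pB1 : (k : ℕ) → (Fin k → 𝒳) → ℝ)
    (hpB0 : ∀ k (xs : Fin k → 𝒳), pB0 k xs = likelihood p μ₀ xs)
    (hpB1 : ∀ k (xs : Fin k → 𝒳), pB1 k xs = bayesMarginal p M₁ ω₁ xs)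
    -- a probability mass function on switching times, supported on powers of two:
    (pri : ℕ → ℝ) (hpri_nonneg : ∀ t, 0 ≤ pri t) (hpri_sum : (∑' t : ℕ, pri t) = 1)
    (hpri_supp : ∀ t, pri t ≠ 0 → ∃ i : ℕ, t = 2 ^ i)
    -- `X₁, X₂, …` i.i.d. with density `p_{μ₀}`:
    {Ω : Type*} [MeasurableSpace Ω] (P : Measure Ω) [IsProbabilityMeasure P]
    (X : ℕ → Ω → 𝒳) (hXmeas : ∀ i, Measurable (X i))
    (hXindep : iIndepFun X P)
    (hXlaw : ∀ i, Measure.map (X i) P = ν.withDensity fun x => ENNReal.ofReal (p μ₀ x)) :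
    ∀ α : ℝ, α ∈ Set.Ioc (0:ℝ) 1 →
      P {ω | ∃ n : ℕ, 0 < n ∧
          (∏ i : Fin n, p μ₀ (X i ω)) /
            pSwitch pB0 pB1 pri (fun i : Fin n => X i ω) ≤ α}
        ≤ ENNReal.ofReal α := by
  rintro α ⟨hα, -⟩
  obtain ⟨ρ, hρ, hρ0, hρp⟩ := hF.exists_measurable_ratio hμ₀
  have hM : MeasurableSet M₁ := hF.isOpen.measurableSet
  set Λ : Measure (Fin m → ℝ) := (volume.restrict M₁).withDensity fun μ => ENNReal.ofReal (ω₁ μ)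
    with hΛ
  have hΛuniv : Λ univ = 1 := by
    rw [hΛ, withDensity_apply _ MeasurableSet.univ, Measure.restrict_univ,
      ← ofReal_integral_eq_lintegral_ofReal, hω₁int, ENNReal.ofReal_one]
    · by_contra h
      rw [integral_undef h] at hω₁int
      exact zero_ne_one hω₁int
    · filter_upwards [ae_restrict_mem hM] with μ hμ using (hω₁pos μ hμ).le
  have : IsProbabilityMeasure Λ := ⟨hΛuniv⟩
  have hint : ∀ᵐ μ ∂Λ, ∀ i, ∫⁻ ω, ρ μ (X i ω) ∂P ≤ 1 := by
    have hac : Λ ≪ volume.restrict M₁ := withDensity_absolutelyContinuous _ _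
    filter_upwards [hac.ae_le hρp, hac.ae_le (ae_restrict_mem hM)] with μ hμ hμM i
    have hρμ : Measurable (ρ μ) := hρ.comp (measurable_const.prodMk measurable_id)
    rw [← lintegral_map hρμ (hXmeas i), hXlaw i,
      lintegral_withDensity_eq_lintegral_mul _ (hF.p_meas μ₀).ennreal_ofReal hρμ]
    have hmul : ∀ x, ((fun x => ENNReal.ofReal (p μ₀ x)) * ρ μ) x = ENNReal.ofReal (p μ x) := by
      intro x
      have hpos := hF.pos hμ₀ x
      rw [Pi.mul_apply, hμ x, ← ENNReal.ofReal_mul hpos.le, mul_div_cancel₀ _ hpos.ne']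
    rw [lintegral_congr hmul, ← ofReal_integral_eq_lintegral_ofReal (hF.integrable hμM)
      (ae_of_all _ fun x => (hF.pos hμM x).le), hF.p_prob μ hμM, ENNReal.ofReal_one]
  have hne : ∀ (x : ℕ → 𝒳) n, mixtureRatio Λ ρ x n ≠ 0 := by
    intro x n h
    have hmeas : Measurable fun μ => ∏ i ∈ Finset.range n, ρ μ (x i) :=
      Finset.measurable_fun_prod _ fun i _ => hρ.comp (measurable_id.prodMk measurable_const)
    rw [mixtureRatio, lintegral_eq_zero_iff hmeas] at h
    obtain ⟨μ, hμ⟩ := h.exists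
    exact Finset.prod_ne_zero_iff.2 (fun i _ => hρ0 μ (x i)) hμ
  set c : (ℕ → 𝒳) → ℕ → ℝ := fun x n => ∏ i ∈ Finset.range n, p μ₀ (x i) with hc
  have hcpos : ∀ x n, 0 < c x n := fun x n => Finset.prod_pos fun i _ => hF.pos hμ₀ _
  have hB0 : ∀ (x : ℕ → 𝒳) n, pB0 n (fun i : Fin n => x i) = c x n := fun x n => by
    rw [hpB0, likelihood, hc, Fin.prod_univ_eq_prod_range (fun i => p μ₀ (x i))]
  have hB1 : ∀ (x : ℕ → 𝒳) n, pB1 n (fun i : Fin n => x i)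
      = (mixtureRatio Λ ρ x n).toReal * c x n := fun x n => by
    rw [hpB1]
    exact hF.bayesMarginal_eq hμ₀ hω₁c (fun μ hμ => (hω₁pos μ hμ).le) hρ hρp x n
  have hbar : ∀ (x : ℕ → 𝒳) t n, pBar pB0 pB1 t (fun i : Fin n => x i)
      = c x n * (switchRatio Λ ρ x t n).toReal := by
    intro x t n
    have hpre : ∀ h : t - 1 ≤ n,
        prefixObs (fun i : Fin n => x i) (t - 1) h = fun i : Fin (t - 1) => x i := fun _ => rfl
    unfold pBar switchRatio
    split_ifs with h
    · have h0 := (hcpos x (t - 1)).ne'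
      rw [hpre, hB0, hB1, hB1, ENNReal.toReal_mul, ENNReal.toReal_inv,
        mul_comm (mixtureRatio Λ ρ x (t - 1)).toReal, mul_div_mul_left _ _ h0, div_eq_mul_inv]
      ring
    · rw [hB0, ENNReal.toReal_one, mul_one]
  have hpri : Summable pri := by
    by_contra h
    rw [tsum_eq_zero_of_not_summable h] at hpri_sum
    exact zero_ne_one hpri_sum
  obtain ⟨t₀, ht₀⟩ : ∃ t, 0 < pri t := by
    by_contra! h
    have hzero : ∀ t, pri t = 0 := fun t => le_antisymm (h t) (hpri_nonneg t)
    simp [hzero] at hpri_sum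
  have hw : ∑' t, ENNReal.ofReal (pri t) = 1 := by
    rw [← ENNReal.ofReal_tsum_of_nonneg hpri_nonneg hpri, hpri_sum, ENNReal.ofReal_one]
  have hfin : ∀ᵐ ω ∂P, ∀ n, mixtureRatio Λ ρ (fun i => X i ω) n ≠ ∞ := by
    refine ae_all_iff.2 fun n => ?_
    have hlt : ∫⁻ ω, mixtureRatio Λ ρ (fun i => X i ω) n ∂P ≠ ∞ :=
      ((lintegral_mixtureRatio_le hρ hXmeas hXindep hint n).trans_lt
        (by simp [hΛuniv])).ne
    filter_upwards [ae_lt_top (measurable_mixtureRatio hρ n fun i _ => hXmeas i) hlt]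
      with ω h using h.ne
  have hville := mul_measure_exists_le_tsum_switchRatio_le hρ hXmeas hXindep hint _ hw
    (ENNReal.ofReal α)⁻¹
  have hα0 : ENNReal.ofReal α ≠ 0 := by simpa using hα
  rw [mul_comm, ← div_eq_mul_inv,
    ENNReal.div_le_iff hα0 ENNReal.ofReal_ne_top, one_mul] at hville
  refine le_trans (measure_mono_ae ?_) hville
  filter_upwards [hfin] with ω hω
  rintro ⟨n, -, hn⟩
  refine ⟨n, ?_⟩
  set x : ℕ → 𝒳 := fun i => X i ω
  have hs_top : ∀ t, switchRatio Λ ρ x t n ≠ ∞ := by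
    intro t
    unfold switchRatio
    split_ifs
    · exact ENNReal.mul_ne_top (ENNReal.inv_ne_top.2 (hne x _)) (hω n)
    · exact ENNReal.one_ne_top
  have hs_pos : ∀ t, 0 < (switchRatio Λ ρ x t n).toReal := by
    intro t
    refine ENNReal.toReal_pos ?_ (hs_top t)
    unfold switchRatio
    split_ifs
    · exact mul_ne_zero (ENNReal.inv_ne_zero.2 (hω _)) (hne x n)
    · exact one_ne_zero
  set a : ℕ → ℝ := fun t => pri t * (switchRatio Λ ρ x t n).toReal with ha
  have ha_nonneg : ∀ t, 0 ≤ a t := fun t => mul_nonneg (hpri_nonneg t) (hs_pos t).le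
  have ha_sum : Summable a := by
    refine (summable_congr_atTop ?_).2 hpri
    filter_upwards [Filter.eventually_ge_atTop (n + 1)] with t ht
    simp [ha, switchRatio, show ¬ t - 1 < n by omega]
  have ha_pos : 0 < ∑' t, a t := ha_sum.tsum_pos ha_nonneg t₀ (mul_pos ht₀ (hs_pos t₀))
  have hsw : pSwitch pB0 pB1 pri (fun i : Fin n => x i) = c x n * ∑' t, a t := by
    rw [pSwitch, ← tsum_mul_left]
    refine tsum_congr fun t => ?_
    rw [hbar, ha]
    ring
  have hn' : c x n / pSwitch pB0 pB1 pri (fun i : Fin n => x i) ≤ α := by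
    rwa [← hB0, hpB0]
  rw [hsw, div_mul_cancel_left₀ (hcpos x n).ne', inv_le_comm₀ ha_pos hα] at hn'
  rw [← ENNReal.ofReal_inv_of_pos hα]
  refine (ENNReal.ofReal_le_ofReal hn').trans (le_of_eq ?_)
  rw [ENNReal.ofReal_tsum_of_nonneg ha_nonneg ha_sum]
  refine tsum_congr fun t => ?_
  rw [ha, ENNReal.ofReal_mul (hpri_nonneg t), ENNReal.ofReal_toReal (hs_top t)]

end SwitchPaper
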